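/- arXiv:2503.14047 — 3 statements merged into one kernel-verified Lean document; each statement's English description precedes it below -/
import Mathlib

section
/- Let $f(\mathbf{x})=\sum_{j=1}^q p_j\mathcal{N}_{\mathbf{w}_j,K_j}(\mathbf{x})$ be a Gaussian mixture density on $\mathbb{R}^n$ (with $p_j>0$, $\sum_j p_j=1$, $K_j$ positive definite), and let $a$ be a positive integer. Then $\int_{\mathbb{R}^n} f(\mathbf{x})^a\,\mathrm{d}\mathbf{x} = \sum_{\substack{t_1,\dots,t_q\ge 0\\ t_1+\cdots+t_q=a}}\binom{a}{t_1,\dots,t_q}\Big(\prod_{i=1}^q p_i^{t_i}\Big)D(\hat t)$, where the sum ranges over all tuples of nonnegative integers summing to $a$. -/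
open Matrix MeasureTheory

/-- The Gaussian density on `ℝⁿ` with mean `w` and covariance matrix `K`. -/
noncomputable def gaussianDensity (n : ℕ) (K : Matrix (Fin n) (Fin n) ℝ)
    (w : Fin n → ℝ) (x : Fin n → ℝ) : ℝ :=
  (2 * Real.pi) ^ (-(n : ℝ) / 2) * K.det ^ (-(1 : ℝ) / 2) *
    Real.exp (-(1 / 2) * ((x - w) ⬝ᵥ (K⁻¹ *ᵥ (x - w))))

/-- The quantity `D(t̂)` of Lemma 1: the value of `∫ ∏ⱼ gⱼ^{tⱼ}` for a tuple `t`
of nonnegative exponents summing to `a`, where `M⁻¹ = ∑ⱼ tⱼ Kⱼ⁻¹` and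
`μ = M ∑ⱼ tⱼ Kⱼ⁻¹ wⱼ`. -/
noncomputable def Dcoef (n q : ℕ) (K : Fin q → Matrix (Fin n) (Fin n) ℝ)
    (w : Fin q → (Fin n → ℝ)) (a : ℝ) (t : Fin q → ℝ) : ℝ :=
  let Minv : Matrix (Fin n) (Fin n) ℝ := ∑ j, t j • (K j)⁻¹
  let M : Matrix (Fin n) (Fin n) ℝ := Minv⁻¹
  let μ : Fin n → ℝ := M *ᵥ ∑ j, t j • ((K j)⁻¹ *ᵥ w j)
  (2 * Real.pi) ^ (-(n : ℝ) * (a - 1) / 2) *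
    (∏ i, ((K i).det) ^ (-(t i) / 2)) *
    M.det ^ ((1 : ℝ) / 2) *
    Real.exp (-(1 / 2) *
      ((∑ l, t l * (w l ⬝ᵥ ((K l)⁻¹ *ᵥ w l))) - μ ⬝ᵥ (Minv *ᵥ μ)))

open scoped MatrixOrder in
/-- The centred Gaussian integral of a positive definite quadratic form. -/
theorem integral_exp_neg_half_quadratic {ι : Type*} [Fintype ι] [DecidableEq ι]
    {A : Matrix ι ι ℝ} (hA : A.PosDef) :
    ∫ x : ι → ℝ, Real.exp (-(1 / 2) * (x ⬝ᵥ (A *ᵥ x))) =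
      (2 * Real.pi) ^ ((Fintype.card ι : ℝ) / 2) * A.det ^ (-(1 : ℝ) / 2) := by
  obtain ⟨B, hB⟩ := CStarAlgebra.nonneg_iff_eq_star_mul_self.mp hA.posSemidef.nonneg
  have hdet : A.det = B.det ^ 2 := by
    rw [hB, det_mul, star_eq_conjTranspose, conjTranspose_eq_transpose_of_trivial, det_transpose,
      sq]
  have hB0 : B.det ≠ 0 := fun h ↦ by
    have := hA.det_pos
    simp [hdet, h] at this
  have hquad (x : ι → ℝ) : x ⬝ᵥ (A *ᵥ x) = ∑ i, (toLin' B x) i ^ 2 := by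
    rw [hB, star_eq_conjTranspose, conjTranspose_eq_transpose_of_trivial, ← mulVec_mulVec,
      dotProduct_mulVec, vecMul_transpose, toLin'_apply]
    simp [dotProduct, sq]
  have hexp (y : ι → ℝ) : Real.exp (-(1 / 2) * ∑ i, y i ^ 2) =
      ∏ i, Real.exp (-(1 / 2) * y i ^ 2) := by
    rw [Finset.mul_sum, Real.exp_sum]
  have hcont : Continuous (toLin' B) := LinearMap.continuous_of_finiteDimensional _
  have hmap := integral_map (μ := volume) hcont.aemeasurable
    (f := fun y : ι → ℝ ↦ Real.exp (-(1 / 2) * ∑ i, y i ^ 2))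
    (Continuous.aestronglyMeasurable (by fun_prop))
  simp_rw [hquad]
  rw [← hmap, Real.map_matrix_volume_pi_eq_smul_volume_pi hB0, integral_smul_measure]
  simp_rw [hexp]
  rw [integral_fintype_prod_volume_eq_pow (fun y : ℝ ↦ Real.exp (-(1 / 2) * y ^ 2)),
    integral_gaussian, ENNReal.toReal_ofReal (abs_nonneg _), hdet, smul_eq_mul, mul_comm]
  congr 1
  · rw [show Real.pi / (1 / 2) = 2 * Real.pi by ring, Real.sqrt_eq_rpow, ← Real.rpow_mul_natCast
      (by positivity)]
    congr 1
    ring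
  · rw [neg_div, Real.rpow_neg (sq_nonneg _), ← Real.sqrt_eq_rpow, Real.sqrt_sq_eq_abs, abs_inv]

/-- A weighted sum of positive definite matrices with nonnegative weights, not all zero, is
positive definite. -/
theorem Matrix.PosDef.sum_smul {ι κ : Type*} [Fintype ι] [Fintype κ]
    {A : κ → Matrix ι ι ℝ} (hA : ∀ j, (A j).PosDef) {t : κ → ℝ} (ht : ∀ j, 0 ≤ t j)
    {i : κ} (hi : 0 < t i) : (∑ j, t j • A j).PosDef := by
  classical
  rw [← Finset.add_sum_erase _ _ (Finset.mem_univ i)]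
  exact ((hA i).smul hi).add_posSemidef
    (posSemidef_sum _ fun j _ ↦ (hA j).posSemidef.smul (ht j))

/-- Expansion of a symmetric quadratic form at a difference. -/
theorem Matrix.IsSymm.dotProduct_mulVec_sub {ι : Type*} [Fintype ι] {A : Matrix ι ι ℝ}
    (hA : A.IsSymm) (x w : ι → ℝ) :
    (x - w) ⬝ᵥ (A *ᵥ (x - w)) = x ⬝ᵥ (A *ᵥ x) - 2 * (x ⬝ᵥ (A *ᵥ w)) + w ⬝ᵥ (A *ᵥ w) := by
  have h : w ⬝ᵥ (A *ᵥ x) = x ⬝ᵥ (A *ᵥ w) := by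
    rw [dotProduct_mulVec, ← mulVec_transpose, hA.eq, dotProduct_comm]
  rw [mulVec_sub, dotProduct_sub, sub_dotProduct, sub_dotProduct, h]
  ring

/-- Completing the square in a weighted sum of quadratic forms with different centres. -/
theorem sum_quadratic_eq_quadratic_add {ι κ : Type*} [Fintype ι] [Fintype κ]
    {A : κ → Matrix ι ι ℝ} (hA : ∀ j, (A j).IsSymm) (t : κ → ℝ) (w : κ → ι → ℝ)
    {μ : ι → ℝ} (hμ : (∑ j, t j • A j) *ᵥ μ = ∑ j, t j • (A j *ᵥ w j)) (x : ι → ℝ) :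
    ∑ j, t j * ((x - w j) ⬝ᵥ (A j *ᵥ (x - w j))) =
      (x - μ) ⬝ᵥ ((∑ j, t j • A j) *ᵥ (x - μ)) +
        ((∑ j, t j * (w j ⬝ᵥ (A j *ᵥ w j))) - μ ⬝ᵥ ((∑ j, t j • A j) *ᵥ μ)) := by
  have hS : (∑ j, t j • A j).IsSymm := by
    simp only [IsSymm, transpose_sum, transpose_smul, (hA _).eq]
  have h₁ : x ⬝ᵥ ((∑ j, t j • A j) *ᵥ x) = ∑ j, t j * (x ⬝ᵥ (A j *ᵥ x)) := by
    simp [sum_mulVec, dotProduct_sum, smul_mulVec]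
  have h₂ : x ⬝ᵥ ((∑ j, t j • A j) *ᵥ μ) = ∑ j, t j * (x ⬝ᵥ (A j *ᵥ w j)) := by
    simp [hμ, dotProduct_sum]
  rw [hS.dotProduct_mulVec_sub, h₁, h₂, add_assoc, add_sub_cancel, Finset.mul_sum,
    ← Finset.sum_sub_distrib, ← Finset.sum_add_distrib]
  refine Finset.sum_congr rfl fun j _ ↦ ?_
  rw [(hA j).dotProduct_mulVec_sub]
  ring

/-- The integral of a product of natural powers of Gaussian densities. -/
theorem integral_prod_gaussianDensity_pow {n q : ℕ} {K : Fin q → Matrix (Fin n) (Fin n) ℝ}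
    (hK : ∀ i, (K i).PosDef) (w : Fin q → Fin n → ℝ) {t : Fin q → ℕ} (ht : ∑ i, t i ≠ 0) :
    ∫ x : Fin n → ℝ, ∏ i, gaussianDensity n (K i) (w i) x ^ t i =
      Dcoef n q K w ((∑ i, t i : ℕ) : ℝ) (fun i ↦ (t i : ℝ)) := by
  obtain ⟨i, -, hi⟩ := Finset.exists_ne_zero_of_sum_ne_zero ht
  have hS : (∑ j, (t j : ℝ) • (K j)⁻¹).PosDef :=
    PosDef.sum_smul (fun j ↦ (hK j).inv) (fun j ↦ Nat.cast_nonneg _)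
      (Nat.cast_pos.mpr (Nat.pos_of_ne_zero hi))
  simp only [Dcoef]
  set S : Matrix (Fin n) (Fin n) ℝ := ∑ j, (t j : ℝ) • (K j)⁻¹ with hSdef
  set μ : Fin n → ℝ := S⁻¹ *ᵥ ∑ j, (t j : ℝ) • ((K j)⁻¹ *ᵥ w j) with hμdef
  have hμ : S *ᵥ μ = ∑ j, (t j : ℝ) • ((K j)⁻¹ *ᵥ w j) := by
    rw [hμdef, mulVec_mulVec, mul_nonsing_inv _ hS.det_pos.ne'.isUnit, one_mulVec]
  have hsymm (j : Fin q) : ((K j)⁻¹).IsSymm := by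
    simpa [IsSymm, IsHermitian, conjTranspose_eq_transpose_of_trivial] using (hK j).inv.isHermitian
  set c : ℝ := (∑ l, (t l : ℝ) * (w l ⬝ᵥ ((K l)⁻¹ *ᵥ w l))) - μ ⬝ᵥ (S *ᵥ μ) with hc
  have hpi : (0 : ℝ) < 2 * Real.pi := by positivity
  have hfun (x : Fin n → ℝ) : ∏ i, gaussianDensity n (K i) (w i) x ^ t i =
      (2 * Real.pi) ^ (-(n : ℝ) / 2 * ((∑ i, t i : ℕ) : ℝ)) *
        (∏ i, ((K i).det) ^ (-(t i : ℝ) / 2)) * Real.exp (-(1 / 2) * c) *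
        Real.exp (-(1 / 2) * ((x - μ) ⬝ᵥ (S *ᵥ (x - μ)))) := by
    rw [mul_assoc _ (Real.exp _), ← Real.exp_add, ← mul_add, add_comm c, hc,
      ← sum_quadratic_eq_quadratic_add hsymm _ w hμ x, Finset.mul_sum, Real.exp_sum]
    simp only [gaussianDensity, mul_pow, Finset.prod_mul_distrib]
    congr 1
    · congr 1
      · rw [Finset.prod_pow_eq_pow_sum, ← Real.rpow_mul_natCast hpi.le]
      · refine Finset.prod_congr rfl fun j _ ↦ ?_
        rw [← Real.rpow_mul_natCast (hK j).det_pos.le]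
        congr 1
        ring
    · refine Finset.prod_congr rfl fun j _ ↦ ?_
      rw [← Real.exp_nat_mul]
      congr 1
      ring
  simp_rw [hfun]
  rw [integral_const_mul,
    integral_sub_right_eq_self (fun x : Fin n → ℝ ↦ Real.exp (-(1 / 2) * (x ⬝ᵥ (S *ᵥ x)))) μ,
    integral_exp_neg_half_quadratic hS, Fintype.card_fin, det_nonsing_inv, Ring.inverse_eq_inv',
    Real.inv_rpow hS.det_pos.le, neg_div (2 : ℝ) 1, Real.rpow_neg hS.det_pos.le,
    show -(n : ℝ) * (((∑ i, t i : ℕ) : ℝ) - 1) / 2 =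
      -(n : ℝ) / 2 * ((∑ i, t i : ℕ) : ℝ) + (n : ℝ) / 2 by ring, Real.rpow_add hpi]
  ring

/-- `Dcoef` is positive on tuples of naturals that are not all zero. -/
theorem Dcoef_pos {n q : ℕ} {K : Fin q → Matrix (Fin n) (Fin n) ℝ}
    (hK : ∀ i, (K i).PosDef) (w : Fin q → Fin n → ℝ) (a : ℝ) {t : Fin q → ℕ}
    (ht : ∑ i, t i ≠ 0) : 0 < Dcoef n q K w a (fun i ↦ (t i : ℝ)) := by
  obtain ⟨i, -, hi⟩ := Finset.exists_ne_zero_of_sum_ne_zero ht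
  have hS : (∑ j, (t j : ℝ) • (K j)⁻¹).PosDef :=
    PosDef.sum_smul (fun j ↦ (hK j).inv) (fun j ↦ Nat.cast_nonneg _)
      (Nat.cast_pos.mpr (Nat.pos_of_ne_zero hi))
  have hdet := Finset.prod_pos fun (j : Fin q) (_ : j ∈ Finset.univ) ↦
    Real.rpow_pos_of_pos (hK j).det_pos (-(t j : ℝ) / 2)
  have hM := Real.rpow_pos_of_pos hS.inv.det_pos ((1 : ℝ) / 2)
  simp only [Dcoef]
  positivity

theorem mixture_power_integral
    (n q : ℕ) (hn : 0 < n) (hq : 0 < q)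
    (p : Fin q → ℝ) (hp : ∀ j, 0 < p j) (hp1 : ∑ j, p j = 1)
    (K : Fin q → Matrix (Fin n) (Fin n) ℝ) (hK : ∀ i, (K i).PosDef)
    (w : Fin q → (Fin n → ℝ))
    (a : ℕ) (ha : 0 < a) :
    ∫ x : Fin n → ℝ, (∑ j, p j * gaussianDensity n (K j) (w j) x) ^ a =
      ∑ t ∈ Finset.Nat.antidiagonalTuple q a,
        (Nat.multinomial Finset.univ t : ℝ) * (∏ i, p i ^ t i) *
          Dcoef n q K w (a : ℝ) (fun i => (t i : ℝ)) := by
  have hset : Finset.piAntidiag Finset.univ a = Finset.Nat.antidiagonalTuple q a := by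
    ext t
    simp [Finset.Nat.mem_antidiagonalTuple]
  have hterm : ∀ t ∈ Finset.Nat.antidiagonalTuple q a,
      ∫ x : Fin n → ℝ, ∏ i, gaussianDensity n (K i) (w i) x ^ t i =
        Dcoef n q K w (a : ℝ) (fun i ↦ (t i : ℝ)) ∧ ∑ i, t i ≠ 0 := fun t ht ↦ by
    obtain rfl := Finset.Nat.mem_antidiagonalTuple.mp ht
    exact ⟨integral_prod_gaussianDensity_pow hK w ha.ne', ha.ne'⟩
  simp_rw [Finset.sum_pow_eq_sum_piAntidiag, hset, mul_pow, Finset.prod_mul_distrib, ← mul_assoc]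
  rw [integral_finsetSum]
  · refine Finset.sum_congr rfl fun t ht ↦ ?_
    rw [integral_const_mul, (hterm t ht).1]
  · intro t ht
    refine Integrable.const_mul (.of_integral_ne_zero ?_) _
    rw [(hterm t ht).1]
    exact (Dcoef_pos hK w a (hterm t ht).2).ne'
end

section
/- Let $f(\mathbf{x})=\sum_{j=1}^q p_j\mathcal{N}_{\mathbf{w}_j,K_j}(\mathbf{x})$ be a Gaussian mixture density on $\mathbb{R}^n$ and let $m\ge \sup_{\mathbf{x}\in\mathbb{R}^n}f(\mathbf{x})$. For each integer $K\ge 1$ define $L_K=-\ln m+\sum_{k=1}^{K}\frac1k\int_{\mathbb{R}^n}f(\mathbf{x})\Big(1-\frac{f(\mathbf{x})}{m}\Big)^k\mathrm{d}\mathbf{x}$. Then the sequence $(L_K)_{K\ge 1}$ is nondecreasing and $L_K\le h(\mathbf{X})=-\int_{\mathbb{R}^n}f(\mathbf{x})\ln f(\mathbf{x})\,\mathrm{d}\mathbf{x}$ for every $K$. -/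
open Matrix MeasureTheory

/-- A positive definite real matrix is `BᵀB` for some invertible `B`. -/
lemma exists_transpose_mul_self_of_posDef {n : ℕ} {A : Matrix (Fin n) (Fin n) ℝ}
    (hA : A.PosDef) : ∃ B : Matrix (Fin n) (Fin n) ℝ, B.det ≠ 0 ∧ A = Bᵀ * B := by
  open scoped MatrixOrder in
  obtain ⟨B, hB⟩ := CStarAlgebra.nonneg_iff_eq_star_mul_self.1 hA.posSemidef.nonneg
  rw [star_eq_conjTranspose, conjTranspose_eq_transpose_of_trivial] at hB
  refine ⟨B, fun h => hA.det_pos.ne' ?_, hB⟩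
  rw [hB, det_mul, h, mul_zero]

lemma dotProduct_transpose_mul_self_mulVec {n : ℕ} (B : Matrix (Fin n) (Fin n) ℝ)
    (v : Fin n → ℝ) : v ⬝ᵥ ((Bᵀ * B) *ᵥ v) = ∑ i, (B *ᵥ v) i ^ 2 := by
  rw [← mulVec_mulVec, dotProduct_mulVec, vecMul_transpose, dotProduct]
  exact Finset.sum_congr rfl fun i _ => (sq _).symm

lemma integrable_comp_mulVec_sub {n : ℕ} {B : Matrix (Fin n) (Fin n) ℝ} (hB : B.det ≠ 0)
    {g : (Fin n → ℝ) → ℝ} (hg : Integrable g) (w : Fin n → ℝ) :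
    Integrable (fun x => g (B *ᵥ (x - w))) := by
  have hmap := Real.map_matrix_volume_pi_eq_smul_volume_pi hB
  have h : Integrable g (Measure.map (toLin' B) volume) := by
    rw [hmap]
    exact hg.smul_measure ENNReal.ofReal_ne_top
  exact (h.comp_measurable (LinearMap.continuous_of_finiteDimensional _).measurable).comp_sub_right w

lemma integral_comp_mulVec_sub {n : ℕ} {B : Matrix (Fin n) (Fin n) ℝ} (hB : B.det ≠ 0)
    {g : (Fin n → ℝ) → ℝ} (hg : Continuous g) (w : Fin n → ℝ) :
    ∫ x, g (B *ᵥ (x - w)) = |B.det|⁻¹ * ∫ y, g y := by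
  have hmap := Real.map_matrix_volume_pi_eq_smul_volume_pi hB
  rw [integral_sub_right_eq_self (fun x => g (B *ᵥ x)) w]
  have h := integral_map (μ := volume)
    (LinearMap.continuous_of_finiteDimensional (toLin' B)).measurable.aemeasurable
    hg.aestronglyMeasurable
  simp only [toLin'_apply] at h
  rw [← h, hmap, integral_smul_measure, ENNReal.toReal_ofReal (abs_nonneg _), abs_inv, smul_eq_mul]

lemma exp_neg_mul_sum_sq {n : ℕ} (c : ℝ) (y : Fin n → ℝ) :
    Real.exp (-c * ∑ i, y i ^ 2) = ∏ i, Real.exp (-c * y i ^ 2) := by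
  rw [Finset.mul_sum, Real.exp_sum]

lemma integrable_exp_neg_mul_sum_sq {n : ℕ} {c : ℝ} (hc : 0 < c) :
    Integrable (fun y : Fin n → ℝ => Real.exp (-c * ∑ i, y i ^ 2)) := by
  simp_rw [exp_neg_mul_sum_sq]
  exact Integrable.fintype_prod fun _ => integrable_exp_neg_mul_sq hc

lemma integral_exp_neg_mul_sum_sq {n : ℕ} (c : ℝ) :
    ∫ y : Fin n → ℝ, Real.exp (-c * ∑ i, y i ^ 2) = √(Real.pi / c) ^ n := by
  simp_rw [exp_neg_mul_sum_sq]
  rw [integral_fintype_prod_volume_eq_pow fun t : ℝ => Real.exp (-c * t ^ 2), integral_gaussian,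
    Fintype.card_fin]

/-- The exponential of a negative definite quadratic form is integrable. -/
lemma integrable_exp_neg_mul_quadratic {n : ℕ} {A : Matrix (Fin n) (Fin n) ℝ} (hA : A.PosDef)
    (w : Fin n → ℝ) {c : ℝ} (hc : 0 < c) :
    Integrable (fun x => Real.exp (-c * ((x - w) ⬝ᵥ (A *ᵥ (x - w))))) := by
  obtain ⟨B, hB, rfl⟩ := exists_transpose_mul_self_of_posDef hA
  simp_rw [dotProduct_transpose_mul_self_mulVec]
  exact integrable_comp_mulVec_sub hB (integrable_exp_neg_mul_sum_sq hc) w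

section GaussianDensity

variable {n : ℕ} {K : Matrix (Fin n) (Fin n) ℝ}

lemma gaussianDensity_pos (hK : K.PosDef) (w x : Fin n → ℝ) : 0 < gaussianDensity n K w x := by
  have := hK.det_pos
  unfold gaussianDensity
  positivity

lemma continuous_gaussianDensity (w : Fin n → ℝ) : Continuous (gaussianDensity n K w) := by
  unfold gaussianDensity
  fun_prop

lemma integrable_gaussianDensity (hK : K.PosDef) (w : Fin n → ℝ) :
    Integrable (gaussianDensity n K w) :=
  (integrable_exp_neg_mul_quadratic hK.inv w one_half_pos).const_mul _

lemma integrable_sqrt_gaussianDensity (hK : K.PosDef) (w : Fin n → ℝ) :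
    Integrable (fun x => √(gaussianDensity n K w x)) := by
  have hd := hK.det_pos
  have h : ∀ x, √(gaussianDensity n K w x) =
      √((2 * Real.pi) ^ (-(n : ℝ) / 2) * K.det ^ (-(1 : ℝ) / 2)) *
        Real.exp (-(1 / 4) * ((x - w) ⬝ᵥ (K⁻¹ *ᵥ (x - w)))) := fun x => by
    rw [gaussianDensity, Real.sqrt_mul (by positivity), ← Real.exp_half]
    congr 2
    ring
  simp_rw [h]
  exact (integrable_exp_neg_mul_quadratic hK.inv w (by norm_num)).const_mul _

lemma gaussianDensity_le (hK : K.PosDef) (w x : Fin n → ℝ) :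
    gaussianDensity n K w x ≤ (2 * Real.pi) ^ (-(n : ℝ) / 2) * K.det ^ (-(1 : ℝ) / 2) := by
  have hd := hK.det_pos
  have hq := hK.inv.posSemidef.dotProduct_mulVec_nonneg (x - w)
  rw [star_trivial] at hq
  refine mul_le_of_le_one_right (by positivity) (Real.exp_le_one_iff.2 ?_)
  linarith

lemma integral_gaussianDensity (hK : K.PosDef) (w : Fin n → ℝ) :
    ∫ x, gaussianDensity n K w x = 1 := by
  obtain ⟨B, hB, hBK⟩ := exists_transpose_mul_self_of_posDef hK.inv
  have hdet : K.det ^ (-(1 : ℝ) / 2) = |B.det| := by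
    have h : K.det⁻¹ = B.det ^ 2 := by
      rw [← Ring.inverse_eq_inv', ← det_nonsing_inv, hBK, det_mul, det_transpose, sq]
    rw [neg_div, Real.rpow_neg hK.det_pos.le, ← Real.inv_rpow hK.det_pos.le, h,
      ← Real.sqrt_eq_rpow, Real.sqrt_sq_eq_abs]
  have hpi : (2 * Real.pi) ^ (-(n : ℝ) / 2) = (√(2 * Real.pi) ^ n)⁻¹ := by
    rw [neg_div, Real.rpow_neg (by positivity), Real.sqrt_eq_rpow,
      ← Real.rpow_mul_natCast (by positivity)]
    congr 2
    ring
  simp_rw [gaussianDensity, hBK, dotProduct_transpose_mul_self_mulVec]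
  rw [integral_const_mul,
    integral_comp_mulVec_sub (g := fun y => Real.exp (-(1 / 2) * ∑ i, y i ^ 2)) hB (by fun_prop) w,
    integral_exp_neg_mul_sum_sq, hdet, hpi, show Real.pi / (1 / 2) = 2 * Real.pi by ring]
  have := abs_pos.2 hB
  field_simp

end GaussianDensity

lemma sqrt_sum_le_sum_sqrt {ι : Type*} (s : Finset ι) {a : ι → ℝ} (ha : ∀ i ∈ s, 0 ≤ a i) :
    √(∑ i ∈ s, a i) ≤ ∑ i ∈ s, √(a i) := by
  refine Real.sqrt_le_iff.2 ⟨Finset.sum_nonneg fun _ _ => Real.sqrt_nonneg _, ?_⟩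
  calc ∑ i ∈ s, a i = ∑ i ∈ s, √(a i) ^ 2 :=
        Finset.sum_congr rfl fun i hi => (Real.sq_sqrt (ha i hi)).symm
    _ ≤ (∑ i ∈ s, √(a i)) ^ 2 :=
        Finset.sum_sq_le_sq_sum_of_nonneg fun _ _ => Real.sqrt_nonneg _

lemma abs_mul_log_le {t M : ℝ} (ht : 0 < t) (hM : t ≤ M) :
    |t * Real.log t| ≤ M * t + 2 * √t := by
  have h1 : Real.log t ≤ t := (Real.log_le_sub_one_of_pos ht).trans (by linarith)
  have hs : 0 < √t := Real.sqrt_pos.2 ht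
  have h2 : -Real.log t ≤ 2 * (√t)⁻¹ := by
    have h := Real.log_le_sub_one_of_pos (inv_pos.2 hs)
    rw [Real.log_inv, Real.log_sqrt ht.le] at h
    linarith
  have h3 : t * (√t)⁻¹ = √t := by
    rw [← div_eq_mul_inv, Real.div_sqrt]
  rw [abs_le]
  constructor <;> nlinarith [mul_le_mul_of_nonneg_left h1 ht.le, mul_le_mul_of_nonneg_left h2 ht.le]

/-- The partial sums of the Taylor series of `-log` at `1` are lower bounds on `(0, 1]`. -/
lemma sum_pow_div_le_neg_log {t : ℝ} (ht : 0 < t) (ht1 : t ≤ 1) (N : ℕ) :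
    ∑ k ∈ Finset.Icc 1 N, 1 / (k : ℝ) * (1 - t) ^ k ≤ -Real.log t := by
  have h := Real.hasSum_pow_div_log_of_abs_lt_one (x := 1 - t)
    (by rw [abs_lt]; constructor <;> linarith)
  rw [sub_sub_cancel] at h
  refine le_trans (le_of_eq ?_) (sum_le_hasSum (Finset.range N) (fun k _ => ?_) h)
  · have hIcc : Finset.Icc 1 N = Finset.Ico (0 + 1) (N + 1) := by
      ext k
      simp only [Finset.mem_Icc, Finset.mem_Ico]
      omega
    rw [hIcc, ← Finset.sum_Ico_add' (fun k : ℕ => 1 / (k : ℝ) * (1 - t) ^ k), ← Finset.range_eq_Ico]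
    refine Finset.sum_congr rfl fun k _ => ?_
    push_cast
    ring
  · have : 0 ≤ 1 - t := by linarith
    positivity

theorem taylor_entropy_lower_bounds
    (n q : ℕ) (hn : 0 < n) (hq : 0 < q)
    (p : Fin q → ℝ) (hp : ∀ j, 0 < p j) (hp1 : ∑ j, p j = 1)
    (Kc : Fin q → Matrix (Fin n) (Fin n) ℝ) (hK : ∀ i, (Kc i).PosDef)
    (w : Fin q → (Fin n → ℝ))
    (f : (Fin n → ℝ) → ℝ)
    (hf : ∀ x, f x = ∑ j, p j * gaussianDensity n (Kc j) (w j) x)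
    (m : ℝ) (hm : (⨆ x : Fin n → ℝ, f x) ≤ m)
    (L : ℕ → ℝ)
    (hL : ∀ K : ℕ, L K = -Real.log m +
      ∑ k ∈ Finset.Icc 1 K, (1 / (k : ℝ)) *
        ∫ x : Fin n → ℝ, f x * (1 - f x / m) ^ k) :
    (∀ K : ℕ, 1 ≤ K → L K ≤ L (K + 1)) ∧
    (∀ K : ℕ, 1 ≤ K → L K ≤ -∫ x : Fin n → ℝ, f x * Real.log (f x)) := by
  have hgpos := fun j => gaussianDensity_pos (hK j) (w j)
  have hf' : f = fun x => ∑ j, p j * gaussianDensity n (Kc j) (w j) x := funext hf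
  have hpos : ∀ x, 0 < f x := fun x => by
    rw [hf]
    exact Finset.sum_pos (fun j _ => mul_pos (hp j) (hgpos j x)) ⟨⟨0, hq⟩, Finset.mem_univ _⟩
  have hbdd : BddAbove (Set.range f) := by
    refine ⟨∑ j, p j * ((2 * Real.pi) ^ (-(n : ℝ) / 2) * (Kc j).det ^ (-(1 : ℝ) / 2)), ?_⟩
    rintro _ ⟨x, rfl⟩
    rw [hf]
    exact Finset.sum_le_sum fun j _ =>
      mul_le_mul_of_nonneg_left (gaussianDensity_le (hK j) (w j) x) (hp j).le
  have hfm : ∀ x, f x ≤ m := fun x => (le_ciSup hbdd x).trans hm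
  have hm0 : 0 < m := (hpos 0).trans_le (hfm 0)
  have hcont : Continuous f := by
    rw [hf']
    exact continuous_finsetSum _ fun j _ => (continuous_gaussianDensity (w j)).const_mul _
  have hint : Integrable f := by
    rw [hf']
    exact integrable_finsetSum _ fun j _ => (integrable_gaussianDensity (hK j) (w j)).const_mul _
  have hint1 : ∫ x, f x = 1 := by
    simp_rw [hf]
    rw [integral_finsetSum _ fun j _ => (integrable_gaussianDensity (hK j) (w j)).const_mul _]
    simp_rw [integral_const_mul, integral_gaussianDensity (hK _), mul_one, hp1]
  have hsqrt : Integrable fun x => √(f x) := by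
    refine Integrable.mono' (integrable_finsetSum Finset.univ fun j _ =>
      (integrable_sqrt_gaussianDensity (hK j) (w j)).const_mul (√(p j)))
      hcont.sqrt.aestronglyMeasurable (ae_of_all _ fun x => ?_)
    rw [Real.norm_of_nonneg (Real.sqrt_nonneg _), hf]
    refine (sqrt_sum_le_sum_sqrt _ fun j _ => (mul_pos (hp j) (hgpos j x)).le).trans_eq ?_
    exact Finset.sum_congr rfl fun j _ => Real.sqrt_mul (hp j).le _
  have hlog : Integrable fun x => f x * Real.log (f x) :=
    ((hint.const_mul m).add (hsqrt.const_mul 2)).mono'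
      (Real.continuous_mul_log.comp hcont).aestronglyMeasurable
      (ae_of_all _ fun x => abs_mul_log_le (hpos x) (hfm x))
  have hratio : ∀ x, 0 ≤ 1 - f x / m ∧ 1 - f x / m ≤ 1 := fun x =>
    ⟨sub_nonneg.2 ((div_le_one hm0).2 (hfm x)), sub_le_self _ (div_pos (hpos x) hm0).le⟩
  have hterm : ∀ x k, 0 ≤ f x * (1 - f x / m) ^ k := fun x k =>
    mul_nonneg (hpos x).le (pow_nonneg (hratio x).1 k)
  have htermint : ∀ k : ℕ, Integrable fun x => f x * (1 - f x / m) ^ k := fun k =>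
    hint.mono' (by fun_prop) (ae_of_all _ fun x => by
      rw [Real.norm_of_nonneg (hterm x k)]
      exact mul_le_of_le_one_right (hpos x).le (pow_le_one₀ (hratio x).1 (hratio x).2))
  constructor
  · intro N _
    rw [hL, hL, Finset.sum_Icc_succ_top (by omega)]
    have : 0 ≤ 1 / ((N + 1 : ℕ) : ℝ) * ∫ x, f x * (1 - f x / m) ^ (N + 1) :=
      mul_nonneg (by positivity) (integral_nonneg fun x => hterm x _)
    linarith
  · intro N _
    have hsumint : Integrable fun x =>
        ∑ k ∈ Finset.Icc 1 N, 1 / (k : ℝ) * (f x * (1 - f x / m) ^ k) :=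
      integrable_finsetSum _ fun k _ => (htermint k).const_mul _
    have hL' : L N = ∫ x, (-Real.log m * f x +
        ∑ k ∈ Finset.Icc 1 N, 1 / (k : ℝ) * (f x * (1 - f x / m) ^ k)) := by
      rw [integral_add (hint.const_mul _) hsumint, integral_const_mul, hint1, mul_one,
        integral_finsetSum _ fun k _ => (htermint k).const_mul _, hL]
      simp_rw [integral_const_mul]
    rw [hL', ← integral_neg]
    refine integral_mono ((hint.const_mul _).add hsumint) hlog.neg fun x => ?_
    have h := mul_le_mul_of_nonneg_left
      (sum_pow_div_le_neg_log (div_pos (hpos x) hm0) ((div_le_one hm0).2 (hfm x)) N) (hpos x).le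
    rw [Real.log_div (hpos x).ne' hm0.ne', Finset.mul_sum] at h
    simp_rw [mul_left_comm (f x)] at h
    dsimp only
    linarith
end

section
/- Let $b>0$, $r>-3$, $C\ge 1$ an integer, and consider the interval $\mathcal I=(0,b]$ with weight $w(s)=s^r$ and $f(s)=-s\ln s$, so that $(M_{\mathcal I})_{ij}=\frac{b^{i+j+r+1}}{i+j+r+1}$ and $(\vec z_{\mathcal I})_i=\frac{b^{i+r+2}}{(i+r+2)^2}-\frac{b^{i+r+2}\ln b}{i+r+2}$ for $1\le i,j\le C$. Let $\tilde M$ be the $C\times C$ matrix with $\tilde M_{ij}=\frac{1}{i+j+r+1}$ and $\vec{\tilde z}$ the vector with $\tilde z_i=\frac{1}{(i+r+2)^2}$, and let $\vec{\tilde d}$ satisfy $\tilde M\vec{\tilde d}=\vec{\tilde z}$. Then the vector $\vec d$ defined by $d_1=\tilde d_1-\ln b$ and $d_i=b^{1-i}\tilde d_i$ for $i\ge 2$ satisfies $M_{\mathcal I}\vec d=\vec z_{\mathcal I}$. -/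
open Matrix

theorem polyfit_rescaling
    (b r : ℝ) (hb : 0 < b) (hr : -3 < r)
    (C : ℕ) (hC : 1 ≤ C)
    (M : Matrix (Fin C) (Fin C) ℝ)
    (hM : ∀ i j : Fin C,
      M i j = b ^ (((i : ℕ) : ℝ) + 1 + (((j : ℕ) : ℝ) + 1) + r + 1) /
        (((i : ℕ) : ℝ) + 1 + (((j : ℕ) : ℝ) + 1) + r + 1))
    (z : Fin C → ℝ)
    (hz : ∀ i : Fin C,
      z i = b ^ (((i : ℕ) : ℝ) + 1 + r + 2) / (((i : ℕ) : ℝ) + 1 + r + 2) ^ 2 -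
        b ^ (((i : ℕ) : ℝ) + 1 + r + 2) * Real.log b / (((i : ℕ) : ℝ) + 1 + r + 2))
    (Mt : Matrix (Fin C) (Fin C) ℝ)
    (hMt : ∀ i j : Fin C,
      Mt i j = 1 / (((i : ℕ) : ℝ) + 1 + (((j : ℕ) : ℝ) + 1) + r + 1))
    (zt : Fin C → ℝ)
    (hzt : ∀ i : Fin C, zt i = 1 / (((i : ℕ) : ℝ) + 1 + r + 2) ^ 2)
    (dt : Fin C → ℝ) (hdt : Mt *ᵥ dt = zt)
    (d : Fin C → ℝ)
    (hd : ∀ i : Fin C,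
      d i = if (i : ℕ) = 0 then dt i - Real.log b
            else b ^ ((1 : ℝ) - (((i : ℕ) : ℝ) + 1)) * dt i) :
    M *ᵥ d = z := by
  ext i
  set p : ℝ := ((i : ℕ) : ℝ) + 1 + r + 2 with hp
  have term (j : Fin C) : M i j * d j =
      b ^ p * (Mt i j * dt j) - if j = ⟨0, hC⟩ then b ^ p * Real.log b / p else 0 := by
    rw [hM, hMt, hd]
    by_cases hj : (j : ℕ) = 0
    · have hexp : ((i : ℕ) : ℝ) + 1 + (((j : ℕ) : ℝ) + 1) + r + 1 = p := by
        rw [hj, hp]; push_cast; ring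
      rw [if_pos hj, if_pos (Fin.ext hj), hexp]
      ring
    · rw [if_neg hj, if_neg fun h => hj (congrArg Fin.val h)]
      have hpow : b ^ p = b ^ (((i : ℕ) : ℝ) + 1 + (((j : ℕ) : ℝ) + 1) + r + 1) *
          b ^ ((1 : ℝ) - (((j : ℕ) : ℝ) + 1)) := by
        rw [← Real.rpow_add hb]
        congr 1
        rw [hp]; ring
      rw [hpow]
      ring
  have hsum : ∑ j, Mt i j * dt j = 1 / p ^ 2 := (congrFun hdt i).trans (hzt i)
  calc (M *ᵥ d) i = ∑ j, M i j * d j := rfl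
    _ = b ^ p * ∑ j, Mt i j * dt j - b ^ p * Real.log b / p := by
      simp only [term, Finset.sum_sub_distrib, ← Finset.mul_sum, Finset.sum_ite_eq',
        Finset.mem_univ, if_true]
    _ = z i := by rw [hsum, hz]; ring
end
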